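/- In C[x,y,z,t], with X = x+y+z+t, Y = x-y-z+t, Z = x-y+z-t, T = x+y-z-t, the polynomial identity X^4 + Y^4 + Z^4 + T^4 - 4*X*Y*Z*T = 32*(x^2*y^2 + z^2*t^2 + x^2*z^2 + y^2*t^2 + x^2*t^2 + y^2*z^2 + 2*x*y*z*t) holds; consequently the two Kummer quartic surfaces of equations x^4+y^4+z^4+t^4-4xyzt = 0 and x^2*y^2+z^2*t^2+x^2*z^2+y^2*t^2+x^2*t^2+y^2*z^2+2xyzt = 0 in P^3 are projectively equivalent (one is obtained from the other by an invertible linear change of coordinates). -/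

import Mathlib

/-- The quartic `K₀' : x⁴ + y⁴ + z⁴ + t⁴ - 4xyzt`. -/
def K1 (v : Fin 4 → ℂ) : ℂ :=
  v 0 ^ 4 + v 1 ^ 4 + v 2 ^ 4 + v 3 ^ 4 - 4 * (v 0 * v 1 * v 2 * v 3)

/-- The quartic `K₀'' : x²y² + z²t² + x²z² + y²t² + x²t² + y²z² + 2xyzt`. -/
def K2 (v : Fin 4 → ℂ) : ℂ :=
  v 0 ^ 2 * v 1 ^ 2 + v 2 ^ 2 * v 3 ^ 2 + v 0 ^ 2 * v 2 ^ 2 + v 1 ^ 2 * v 3 ^ 2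
    + v 0 ^ 2 * v 3 ^ 2 + v 1 ^ 2 * v 2 ^ 2 + 2 * (v 0 * v 1 * v 2 * v 3)

/-- With `X = x+y+z+t`, `Y = x-y-z+t`, `Z = x-y+z-t`, `T = x+y-z-t` one has
`X⁴+Y⁴+Z⁴+T⁴-4XYZT = 32(x²y²+z²t²+x²z²+y²t²+x²t²+y²z²+2xyzt)`; consequently the two Kummer
quartic surfaces `K₀' = 0` and `K₀'' = 0` in `ℙ³` are projectively equivalent: some
invertible linear change of coordinates carries the first equation to a nonzero multiple of
the second. -/
theorem two_kummer_quartics_projectively_equivalent :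
    (∀ x y z t : ℂ,
      (x+y+z+t)^4 + (x-y-z+t)^4 + (x-y+z-t)^4 + (x+y-z-t)^4
          - 4*(x+y+z+t)*(x-y-z+t)*(x-y+z-t)*(x+y-z-t)
        = 32*(x^2*y^2 + z^2*t^2 + x^2*z^2 + y^2*t^2 + x^2*t^2 + y^2*z^2 + 2*x*y*z*t)) ∧
    (∃ g : Matrix (Fin 4) (Fin 4) ℂ, IsUnit g ∧
      ∃ c : ℂ, c ≠ 0 ∧ ∀ v : Fin 4 → ℂ, K1 (g.mulVec v) = c * K2 v) := by
  refine ⟨fun x y z t => by ring,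
    !![1, 1, 1, 1; 1, -1, -1, 1; 1, -1, 1, -1; 1, 1, -1, -1], ?_, 32, by norm_num, fun v => ?_⟩
  · rw [Matrix.isUnit_iff_isUnit_det, isUnit_iff_ne_zero]
    simp [Matrix.det_succ_row_zero, Fin.sum_univ_succ, Fin.succAbove]
    norm_num
  · simp only [K1, K2, Matrix.mulVec, dotProduct, Fin.sum_univ_four, Matrix.of_apply,
      Matrix.cons_val]
    ring
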